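/- Let 1 < q < ∞ and suppose α/n > β/m and (α+ρβ)/(n+ρm) = 1 − 1/q. Then there exists a constant C, depending only on n, m, α, β, ρ, q (and not on L or a), such that ∑_{ℓ≥1} ∬_{Q_{0ℓ}} |I a(x,y)|^q dx dy ≤ C for every L ∈ ℤ and every measurable a supported in ½Q with |a| ≤ 2^{(n+m)(1−L)} pointwise (no cancellation hypothesis on a is required). -/

import Mathlib

open MeasureTheory

/-- The flag kernel `Ω(x,y) = |x|^(α-n) (|x|^ρ + |y|)^(β-m)` on `ℝ^n × ℝ^m`. -/
noncomputable def flagKernel (n m : ℕ) (α β ρ : ℝ)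
    (x : EuclideanSpace ℝ (Fin n)) (y : EuclideanSpace ℝ (Fin m)) : ℝ :=
  ‖x‖ ^ (α - (n : ℝ)) * (‖x‖ ^ ρ + ‖y‖) ^ (β - (m : ℝ))

/-- The fractional integral operator `I f(x,y) = ∬ f(u,v) Ω(x-u, y-v) du dv`. -/
noncomputable def flagOp (n m : ℕ) (α β ρ : ℝ)
    (f : EuclideanSpace ℝ (Fin n) × EuclideanSpace ℝ (Fin m) → ℝ)
    (z : EuclideanSpace ℝ (Fin n) × EuclideanSpace ℝ (Fin m)) : ℝ :=
  ∫ w : EuclideanSpace ℝ (Fin n) × EuclideanSpace ℝ (Fin m),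
    f w * flagKernel n m α β ρ (z.1 - w.1) (z.2 - w.2)

/-- The `ℓ^∞` (sup) norm `‖x‖_∞` of a point of Euclidean space. -/
noncomputable def supAbs {n : ℕ} (x : EuclideanSpace ℝ (Fin n)) : ℝ :=
  ‖(WithLp.equiv 2 (Fin n → ℝ)) x‖

lemma supAbs_le_norm {n : ℕ} (x : EuclideanSpace ℝ (Fin n)) : supAbs x ≤ ‖x‖ := by
  unfold supAbs
  exact (pi_norm_le_iff_of_nonneg (norm_nonneg x)).2 fun i => PiLp.norm_apply_le x i

lemma norm_le_mul_supAbs {n : ℕ} (x : EuclideanSpace ℝ (Fin n)) : ‖x‖ ≤ n * supAbs x := by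
  have hi : ∀ i, ‖x i‖ ≤ supAbs x := fun i =>
    norm_le_pi_norm ((WithLp.equiv 2 (Fin n → ℝ)) x) i
  have h0 : 0 ≤ supAbs x := norm_nonneg _
  rw [EuclideanSpace.norm_eq]
  refine Real.sqrt_le_iff.2 ⟨by positivity, ?_⟩
  calc ∑ i, ‖x i‖ ^ 2 ≤ ∑ _i : Fin n, supAbs x ^ 2 := by
        gcongr with i
        exact hi i
    _ = n * supAbs x ^ 2 := by simp
    _ ≤ (n * n : ℝ) * supAbs x ^ 2 := by
        gcongr
        exact_mod_cast Nat.le_mul_self n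
    _ = (n * supAbs x) ^ 2 := by ring

lemma supAbs_sub_le {n : ℕ} (x y : EuclideanSpace ℝ (Fin n)) :
    supAbs (x - y) ≤ supAbs x + supAbs y :=
  norm_sub_le ((WithLp.equiv 2 (Fin n → ℝ)) x) _

lemma supAbs_le_add_supAbs_sub {n : ℕ} (x y : EuclideanSpace ℝ (Fin n)) :
    supAbs x ≤ supAbs (x - y) + supAbs y := by
  have := norm_sub_norm_le ((WithLp.equiv 2 (Fin n → ℝ)) x) ((WithLp.equiv 2 (Fin n → ℝ)) y)
  have h : supAbs x - supAbs y ≤ supAbs (x - y) := this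
  linarith

lemma continuous_supAbs {n : ℕ} : Continuous (supAbs (n := n)) :=
  continuous_norm.comp (PiLp.continuous_ofLp 2 _)

lemma volume_supAbs_le (m : ℕ) {r : ℝ} (hr : 0 ≤ r) :
    volume {y : EuclideanSpace ℝ (Fin m) | supAbs y ≤ r} = ENNReal.ofReal ((2 * r) ^ m) := by
  have h := (PiLp.volume_preserving_ofLp (Fin m)).measure_preimage
    (measurableSet_closedBall (x := (0 : Fin m → ℝ)) (ε := r)).nullMeasurableSet
  rw [Real.volume_pi_closedBall _ hr, Fintype.card_fin] at h
  rw [← h]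
  congr 1
  ext y
  simp [supAbs]

lemma exists_setLIntegral_norm_rpow_le {n : ℕ} (hn : 0 < n) {p : ℝ} (hp : 0 < p + n) :
    ∃ V : ℝ, 0 ≤ V ∧ ∀ R : ℝ, 0 < R →
      ∫⁻ x in Metric.ball (0 : EuclideanSpace ℝ (Fin n)) R, ENNReal.ofReal (‖x‖ ^ p) ≤
        ENNReal.ofReal (V * R ^ (p + n)) := by
  have : Nonempty (Fin n) := ⟨⟨0, hn⟩⟩
  refine ⟨n * (volume.real (Metric.ball (0 : EuclideanSpace ℝ (Fin n)) 1) * (p + n)⁻¹),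
    by positivity, fun R hR => ?_⟩
  have hpow : ∀ y : ℝ, 0 < y → y ^ (n - 1) • y ^ p = y ^ (p + n - 1) := fun y hy => by
    rw [smul_eq_mul, ← Real.rpow_natCast, ← Real.rpow_add hy]
    congr 1
    push_cast [Nat.cast_sub (show 1 ≤ n from hn)]
    ring
  have hint : IntegrableOn (fun x : EuclideanSpace ℝ (Fin n) => ‖x‖ ^ p) (Metric.ball 0 R) := by
    rw [integrableOn_fun_norm_addHaar volume (f := fun t => t ^ p), finrank_euclideanSpace_fin]
    refine IntegrableOn.congr_fun ?_ (fun y hy => (hpow y hy.1).symm) measurableSet_Ioo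
    exact (intervalIntegral.integrableOn_Ioo_rpow_iff hR).2 (by linarith)
  rw [← ofReal_integral_eq_lintegral_ofReal hint (.of_forall fun x => by positivity)]
  apply ENNReal.ofReal_le_ofReal
  apply le_of_eq
  rw [← integral_indicator measurableSet_ball]
  have h1 : (Metric.ball (0 : EuclideanSpace ℝ (Fin n)) R).indicator (fun x => ‖x‖ ^ p) =
      fun x => (Set.Iio R).indicator (fun t : ℝ => t ^ p) ‖x‖ := by
    ext x
    simp [Set.indicator]
  rw [h1, integral_fun_norm_addHaar, finrank_euclideanSpace_fin]
  have h2 : ∫ y in Set.Ioi (0 : ℝ), y ^ (n - 1) • (Set.Iio R).indicator (fun t : ℝ => t ^ p) y =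
      R ^ (p + n) * (p + n)⁻¹ := by
    have h3 : ∀ y : ℝ, y ^ (n - 1) • (Set.Iio R).indicator (fun t : ℝ => t ^ p) y =
        (Set.Iio R).indicator (fun y : ℝ => y ^ (n - 1) • y ^ p) y := fun y => by
      by_cases hy : y < R <;> simp [hy]
    simp_rw [h3]
    rw [setIntegral_indicator measurableSet_Iio, Set.Ioi_inter_Iio,
      setIntegral_congr_fun measurableSet_Ioo (fun y hy => hpow y hy.1),
      ← integral_Ioc_eq_integral_Ioo, ← intervalIntegral.integral_of_le hR.le,
      integral_rpow (Or.inl (by linarith))]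
    rw [sub_add_cancel, Real.zero_rpow hp.ne', sub_zero, div_eq_mul_inv]
  rw [h2]
  simp only [nsmul_eq_mul, smul_eq_mul]
  ring

lemma flagKernel_nonneg (n m : ℕ) (α β ρ : ℝ)
    (x : EuclideanSpace ℝ (Fin n)) (y : EuclideanSpace ℝ (Fin m)) :
    0 ≤ flagKernel n m α β ρ x y := by
  unfold flagKernel
  positivity

/-- Interpolating between the two terms of the second factor of the flag kernel. -/
lemma flagKernel_le {n m : ℕ} {α β ρ s b : ℝ} (hαn : α < n) (hs : 0 ≤ s) (hsm : s ≤ m - β)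
    (hb : 0 < b) (x : EuclideanSpace ℝ (Fin n)) {y : EuclideanSpace ℝ (Fin m)} (hy : b ≤ ‖y‖) :
    flagKernel n m α β ρ x y ≤ ‖x‖ ^ (α - n - ρ * s) * b ^ (β - m + s) := by
  unfold flagKernel
  rcases eq_or_ne x 0 with rfl | hx
  · rw [norm_zero, Real.zero_rpow (by linarith), zero_mul]
    positivity
  have hx0 : 0 < ‖x‖ := norm_pos_iff.2 hx
  have hX : 0 < ‖x‖ ^ ρ := by positivity
  have hsum : 0 < ‖x‖ ^ ρ + ‖y‖ := by positivity
  have e1 : (‖x‖ ^ ρ + ‖y‖) ^ (β - m) =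
      (‖x‖ ^ ρ + ‖y‖) ^ (-s) * (‖x‖ ^ ρ + ‖y‖) ^ (β - m + s) := by
    rw [← Real.rpow_add hsum]
    congr 1
    ring
  have e2 : ‖x‖ ^ (α - n - ρ * s) = ‖x‖ ^ (α - n) * (‖x‖ ^ ρ) ^ (-s) := by
    rw [← Real.rpow_mul hx0.le, ← Real.rpow_add hx0]
    congr 1
    ring
  rw [e1, e2, mul_assoc]
  have i1 : (‖x‖ ^ ρ + ‖y‖) ^ (-s) ≤ (‖x‖ ^ ρ) ^ (-s) :=
    Real.rpow_le_rpow_of_nonpos hX (by linarith [norm_nonneg y]) (by linarith)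
  have i2 : (‖x‖ ^ ρ + ‖y‖) ^ (β - m + s) ≤ b ^ (β - m + s) :=
    Real.rpow_le_rpow_of_nonpos hb (by linarith) (by linarith)
  gcongr

/-- Pointwise bound for `flagOp a` away from the support of `a` in the second variable. -/
lemma exists_abs_flagOp_le {n m : ℕ} (hn : 0 < n) {α β ρ s : ℝ} (hαn : α < n) (hs : 0 ≤ s)
    (hsm : s ≤ m - β) (hsα : ρ * s < α) :
    ∃ V : ℝ, 0 ≤ V ∧ ∀ (A r R b : ℝ)
      (a : EuclideanSpace ℝ (Fin n) × EuclideanSpace ℝ (Fin m) → ℝ)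
      (z : EuclideanSpace ℝ (Fin n) × EuclideanSpace ℝ (Fin m)), 0 ≤ A → 0 ≤ r → 0 < R → 0 < b →
      (∀ w, |a w| ≤ A) →
      (∀ w, a w ≠ 0 → ‖z.1 - w.1‖ < R ∧ supAbs w.2 ≤ r ∧ b ≤ ‖z.2 - w.2‖) →
      |flagOp n m α β ρ a z| ≤
        V * R ^ (α - ρ * s) * (A * b ^ (β - m + s) * (2 * r) ^ m) := by
  obtain ⟨V, hV0, hV⟩ := exists_setLIntegral_norm_rpow_le hn (p := α - n - ρ * s) (by linarith)
  refine ⟨V, hV0, fun A r R b a z hA hr hR hb ha hsupp => ?_⟩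
  set F : EuclideanSpace ℝ (Fin n) → ENNReal :=
    (Metric.ball 0 R).indicator fun x => ENNReal.ofReal (‖x‖ ^ (α - n - ρ * s)) with hF
  set G : EuclideanSpace ℝ (Fin m) → ENNReal :=
    {y | supAbs y ≤ r}.indicator fun _ => ENNReal.ofReal (A * b ^ (β - m + s)) with hG
  have hFm : Measurable F := Measurable.indicator (by fun_prop) measurableSet_ball
  have hset : MeasurableSet {y : EuclideanSpace ℝ (Fin m) | supAbs y ≤ r} :=
    measurableSet_le continuous_supAbs.measurable measurable_const
  have hGm : Measurable G := measurable_const.indicator hset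
  have hpt : ∀ w : EuclideanSpace ℝ (Fin n) × EuclideanSpace ℝ (Fin m),
      ‖a w * flagKernel n m α β ρ (z.1 - w.1) (z.2 - w.2)‖ₑ ≤ F (z.1 - w.1) * G w.2 := by
    intro w
    by_cases hw : a w = 0
    · simp [hw]
    obtain ⟨h1, h2, h3⟩ := hsupp w hw
    have hb1 : z.1 - w.1 ∈ Metric.ball (0 : EuclideanSpace ℝ (Fin n)) R := by simpa using h1
    have hb2 : w.2 ∈ {y : EuclideanSpace ℝ (Fin m) | supAbs y ≤ r} := h2
    rw [hF, hG, Set.indicator_of_mem hb1, Set.indicator_of_mem hb2,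
      ← ENNReal.ofReal_mul (by positivity), Real.enorm_eq_ofReal_abs, abs_mul,
      abs_of_nonneg (flagKernel_nonneg ..)]
    apply ENNReal.ofReal_le_ofReal
    calc |a w| * flagKernel n m α β ρ (z.1 - w.1) (z.2 - w.2)
        ≤ A * (‖z.1 - w.1‖ ^ (α - n - ρ * s) * b ^ (β - m + s)) :=
          mul_le_mul (ha w) (flagKernel_le hαn hs hsm hb _ h3) (flagKernel_nonneg ..) hA
      _ = _ := by ring
  have hbound : ENNReal.ofReal |flagOp n m α β ρ a z| ≤
      ENNReal.ofReal (V * R ^ (α - ρ * s) * (A * b ^ (β - m + s) * (2 * r) ^ m)) := by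
    rw [← Real.enorm_eq_ofReal_abs]
    calc ‖flagOp n m α β ρ a z‖ₑ
        ≤ ∫⁻ w, ‖a w * flagKernel n m α β ρ (z.1 - w.1) (z.2 - w.2)‖ₑ :=
          enorm_integral_le_lintegral_enorm _
      _ ≤ ∫⁻ w : EuclideanSpace ℝ (Fin n) × EuclideanSpace ℝ (Fin m), F (z.1 - w.1) * G w.2 :=
          lintegral_mono hpt
      _ = (∫⁻ x, F (z.1 - x)) * ∫⁻ y, G y := by
          rw [Measure.volume_eq_prod]
          exact lintegral_prod_mul (f := fun x => F (z.1 - x)) (by fun_prop) hGm.aemeasurable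
      _ ≤ ENNReal.ofReal (V * R ^ (α - ρ * s)) *
          (ENNReal.ofReal (A * b ^ (β - m + s)) * ENNReal.ofReal ((2 * r) ^ m)) := by
          rw [lintegral_sub_left_eq_self F z.1, hF, hG, lintegral_indicator measurableSet_ball,
            lintegral_indicator_const hset, volume_supAbs_le m hr]
          have hVR := hV R hR
          rw [show α - n - ρ * s + n = α - ρ * s by ring] at hVR
          gcongr
      _ = _ := by
          rw [← ENNReal.ofReal_mul (by positivity), ← ENNReal.ofReal_mul (by positivity)]
  exact (ENNReal.ofReal_le_ofReal_iff (by positivity)).1 hbound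

/-- The contribution of one shell, with a free interpolation parameter `s`. -/
lemma exists_setLIntegral_shell_le {n m : ℕ} (hn : 0 < n) {α β ρ q s : ℝ} (hαn : α < n)
    (hs : 0 ≤ s) (hsm : s ≤ m - β) (hsα : ρ * s < α) (hq : 0 < q) :
    ∃ K : ℝ, 0 ≤ K ∧ ∀ (X T : ℝ) (a : EuclideanSpace ℝ (Fin n) × EuclideanSpace ℝ (Fin m) → ℝ),
      0 < X → 1 ≤ T →
      (∀ w, a w ≠ 0 → max (supAbs w.1) (supAbs w.2) ≤ X / 4) →
      (∀ w, |a w| ≤ (2 / X) ^ (n + m)) →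
      ∫⁻ w in {w : EuclideanSpace ℝ (Fin n) × EuclideanSpace ℝ (Fin m) |
          supAbs w.1 < X ∧ (X * T ≤ supAbs w.2 ∧ supAbs w.2 < 2 * (X * T))},
        ENNReal.ofReal (|flagOp n m α β ρ a w| ^ q) ≤
        ENNReal.ofReal (K * (X ^ ((α - n + β - m + (1 - ρ) * s) * q + n + m) *
          T ^ ((β - m + s) * q + m))) := by
  obtain ⟨V, hV0, hV⟩ := exists_abs_flagOp_le (n := n) (m := m) hn hαn hs hsm hsα
  set K₁ : ℝ := V * (2 * n) ^ (α - ρ * s) * (2 ^ (n + m) * (1 / 2) ^ (β - m + s) * (1 / 2) ^ m)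
    with hK₁
  have hK₁0 : 0 ≤ K₁ := by positivity
  refine ⟨K₁ ^ q * (2 ^ n * 4 ^ m), by positivity, fun X T a hX hT hsupp ha => ?_⟩
  have hT0 : 0 < T := by linarith
  have hn' : (0 : ℝ) < n := by exact_mod_cast hn
  have hXT : X ≤ X * T := le_mul_of_one_le_right hX.le hT
  set S : Set (EuclideanSpace ℝ (Fin n) × EuclideanSpace ℝ (Fin m)) :=
    {w | supAbs w.1 < X ∧ (X * T ≤ supAbs w.2 ∧ supAbs w.2 < 2 * (X * T))} with hS
  have hm1 : Measurable fun w : EuclideanSpace ℝ (Fin n) × EuclideanSpace ℝ (Fin m) =>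
    supAbs w.1 := (continuous_supAbs.comp continuous_fst).measurable
  have hm2 : Measurable fun w : EuclideanSpace ℝ (Fin n) × EuclideanSpace ℝ (Fin m) =>
    supAbs w.2 := (continuous_supAbs.comp continuous_snd).measurable
  have hSm : MeasurableSet S := (measurableSet_lt hm1 measurable_const).inter
    ((measurableSet_le measurable_const hm2).inter (measurableSet_lt hm2 measurable_const))
  have hSvol : volume S ≤ ENNReal.ofReal ((2 * X) ^ n * (2 * (2 * (X * T))) ^ m) := by
    calc volume S ≤ volume ({x : EuclideanSpace ℝ (Fin n) | supAbs x ≤ X} ×ˢ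
          {y : EuclideanSpace ℝ (Fin m) | supAbs y ≤ 2 * (X * T)}) :=
          measure_mono fun w hw => ⟨hw.1.le, hw.2.2.le⟩
      _ = _ := by
          rw [Measure.volume_eq_prod, Measure.prod_prod, volume_supAbs_le n hX.le,
            volume_supAbs_le m (by positivity), ← ENNReal.ofReal_mul (by positivity)]
  have hpt : ∀ w ∈ S, |flagOp n m α β ρ a w| ≤
      K₁ * (X ^ (α - n + β - m + (1 - ρ) * s) * T ^ (β - m + s)) := by
    rintro w ⟨h1, h2, -⟩
    refine (hV ((2 / X) ^ (n + m)) (X / 4) (2 * n * X) (1 / 2 * (X * T)) a w (by positivity)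
      (by positivity) (by positivity) (by positivity) ha fun v hv => ?_).trans_eq ?_
    · have hv1 := (le_max_left _ _).trans (hsupp v hv)
      have hv2 := (le_max_right _ _).trans (hsupp v hv)
      refine ⟨?_, hv2, ?_⟩
      · have := supAbs_sub_le w.1 v.1
        calc ‖w.1 - v.1‖ ≤ n * supAbs (w.1 - v.1) := norm_le_mul_supAbs _
          _ < n * (2 * X) := by
            gcongr
            linarith
          _ = 2 * n * X := by ring
      · have := supAbs_le_add_supAbs_sub w.2 v.2
        have := supAbs_le_norm (w.2 - v.2)
        linarith
    · have e : X ^ (α - n + β - m + (1 - ρ) * s) =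
          X ^ (α - ρ * s) * X ^ (β - m + s) * (X ^ n)⁻¹ := by
        rw [← Real.rpow_natCast, ← Real.rpow_neg hX.le, ← Real.rpow_add hX, ← Real.rpow_add hX]
        congr 1
        ring
      rw [e, hK₁, Real.mul_rpow (x := 2 * n) (by positivity) hX.le,
        Real.mul_rpow (y := X * T) (by positivity) (by positivity), Real.mul_rpow hX.le hT0.le,
        show 2 * (X / 4) = 1 / 2 * X by ring, mul_pow, div_pow, pow_add X]
      field_simp
  clear_value K₁
  calc ∫⁻ w in S, ENNReal.ofReal (|flagOp n m α β ρ a w| ^ q)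
      ≤ ∫⁻ _ in S, ENNReal.ofReal
          ((K₁ * (X ^ (α - n + β - m + (1 - ρ) * s) * T ^ (β - m + s))) ^ q) := by
        refine setLIntegral_mono' hSm fun w hw => ENNReal.ofReal_le_ofReal ?_
        exact Real.rpow_le_rpow (abs_nonneg _) (hpt w hw) hq.le
    _ = ENNReal.ofReal ((K₁ * (X ^ (α - n + β - m + (1 - ρ) * s) * T ^ (β - m + s))) ^ q) *
          volume S := setLIntegral_const _ _
    _ ≤ ENNReal.ofReal ((K₁ * (X ^ (α - n + β - m + (1 - ρ) * s) * T ^ (β - m + s))) ^ q) *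
          ENNReal.ofReal ((2 * X) ^ n * (2 * (2 * (X * T))) ^ m) := by gcongr
    _ = _ := by
        rw [← ENNReal.ofReal_mul (by positivity), Real.mul_rpow hK₁0 (by positivity),
          Real.mul_rpow (by positivity) (by positivity), ← Real.rpow_mul hX.le,
          ← Real.rpow_mul hT0.le, Real.rpow_add hX, Real.rpow_add hX, Real.rpow_add hT0,
          Real.rpow_natCast, Real.rpow_natCast, Real.rpow_natCast,
          show 2 * (2 * (X * T)) = 4 * (X * T) by ring, mul_pow, mul_pow, mul_pow]
        congr 1
        ring

lemma exists_tsum_rpow_neg_abs_sub_le {c : ℝ} (hc : 0 < c) :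
    ∃ C : ℝ, 0 < C ∧ ∀ t : ℝ,
      ∑' l : ℕ, ENNReal.ofReal ((2 : ℝ) ^ (-(c * |(l : ℝ) - t|))) ≤ ENNReal.ofReal C := by
  have hsum : Summable fun j : ℤ => (2 : ℝ) ^ (-(c * (|(j : ℝ)| - 1))) := by
    have hnat : Summable fun k : ℕ => (2 : ℝ) ^ (-(c * ((k : ℝ) - 1))) := by
      have hg : Summable fun k : ℕ => ((2 : ℝ) ^ (-c)) ^ k :=
        summable_geometric_of_lt_one (by positivity)
          (Real.rpow_lt_one_of_one_lt_of_neg one_lt_two (by linarith))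
      refine (hg.mul_left (2 ^ c)).congr fun k => ?_
      rw [← Real.rpow_natCast, ← Real.rpow_mul zero_le_two, ← Real.rpow_add zero_lt_two]
      congr 1
      ring
    exact Summable.of_nat_of_neg (by simpa using hnat) (by simpa using hnat)
  have hpos : ∀ j : ℤ, 0 ≤ (2 : ℝ) ^ (-(c * (|(j : ℝ)| - 1))) := fun j => by positivity
  refine ⟨∑' j : ℤ, (2 : ℝ) ^ (-(c * (|(j : ℝ)| - 1))),
    hsum.tsum_pos hpos 0 (by positivity), fun t => ?_⟩
  rw [ENNReal.ofReal_tsum_of_nonneg hpos hsum]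
  have hinj : Function.Injective fun l : ℕ => (l : ℤ) - ⌊t⌋ := fun a b h => by
    simpa using h
  refine le_trans ?_ (ENNReal.tsum_comp_le_tsum_of_injective hinj _)
  refine ENNReal.tsum_le_tsum fun l => ENNReal.ofReal_le_ofReal ?_
  refine Real.rpow_le_rpow_of_exponent_le one_le_two (neg_le_neg ?_)
  gcongr
  have h1 := Int.floor_le t
  have h2 := Int.lt_floor_add_one t
  have h3 : |((l : ℝ) - ⌊t⌋)| ≤ |(l : ℝ) - t| + |t - ⌊t⌋| := abs_sub_le _ _ _
  have h4 : |t - ⌊t⌋| ≤ 1 := by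
    rw [abs_le]
    constructor <;> linarith
  push_cast
  linarith

/-- Case 4 (`k = 0, ℓ > 0`): the sum over `ℓ ≥ 1` of the integrals of `|I a|^q`
over the shells `Q_{0ℓ}` is uniformly bounded for functions `a` supported in `½Q`
with `|a| ≤ 2^{(n+m)(1-L)}`; no cancellation is needed. -/
theorem flagOp_atom_case4 (n m : ℕ) (hn : 0 < n) (hm : 0 < m) (α β ρ q : ℝ)
    (hα : 0 < α) (hαn : α < n) (hβ : 0 < β) (hβm : β < m) (hρ : 1 ≤ ρ)
    (hq : 1 < q)
    (hmain : β / m < α / n)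
    (hhom : (α + ρ * β) / (n + ρ * m) = 1 - 1 / q) :
    ∃ C : ℝ, 0 < C ∧
      ∀ (L : ℤ) (a : EuclideanSpace ℝ (Fin n) × EuclideanSpace ℝ (Fin m) → ℝ),
        Measurable a →
        (∀ w, a w ≠ 0 → max (supAbs w.1) (supAbs w.2) ≤ (2 : ℝ) ^ (L - 2)) →
        (∀ w, |a w| ≤ (2 : ℝ) ^ (((n : ℤ) + m) * (1 - L))) →
        ∑' (l : ℕ),
          ∫⁻ w in {w : EuclideanSpace ℝ (Fin n) × EuclideanSpace ℝ (Fin m) |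
              supAbs w.1 < (2 : ℝ) ^ L ∧
              ((2 : ℝ) ^ (L + ((l : ℤ) + 1) - 1) ≤ supAbs w.2 ∧
                supAbs w.2 < (2 : ℝ) ^ (L + ((l : ℤ) + 1)))},
            ENNReal.ofReal (|flagOp n m α β ρ a w| ^ q) ≤ ENNReal.ofReal C := by

  have hn' : (0 : ℝ) < n := by exact_mod_cast hn
  have hm' : (0 : ℝ) < m := by exact_mod_cast hm
  have hq0 : 0 < q := by linarith
  have hρ0 : 0 < ρ := by linarith
  set θ : ℝ := 1 - 1 / q with hθ
  have hqθ : q * θ = q - 1 := by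
    rw [hθ]
    field_simp
  have hθ1 : θ < 1 := by
    have : 0 < 1 / q := by positivity
    linarith
  have hθ0 : 0 < θ := by
    rw [← hhom]
    positivity
  have hhom' : α + ρ * β = θ * (n + ρ * m) := by
    rwa [div_eq_iff (by positivity)] at hhom
  set δ : ℝ := m * θ - β with hδ
  have hαδ : α = n * θ + ρ * δ := by
    rw [hδ]
    linear_combination hhom'
  have hδ0 : 0 < δ := by
    by_contra! h
    have h1 : α ≤ n * θ := by nlinarith
    have h2 : α / n ≤ θ := (div_le_iff₀ hn').2 (by linarith)
    have h3 : θ ≤ β / m := (le_div_iff₀ hm').2 (by linarith)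
    linarith
  have hδm : δ < m - β := by nlinarith
  have hnθ : 0 < n * θ / ρ := by positivity
  obtain ⟨ε, hε0, hε⟩ : ∃ ε : ℝ, 0 < ε ∧ ε < min δ (min (m - β - δ) (n * θ / ρ)) :=
    exists_between (by
      simp only [lt_min_iff]
      exact ⟨hδ0, by linarith, hnθ⟩)
  simp only [lt_min_iff] at hε
  obtain ⟨hε1, hε2, hε3⟩ := hε
  have hε3' : ρ * ε < n * θ := by
    rw [lt_div_iff₀ hρ0] at hε3
    linarith
  have hρε : 0 < ρ * ε := by positivity
  obtain ⟨K₁, hK₁, H₁⟩ := exists_setLIntegral_shell_le (n := n) (m := m) (α := α) (β := β)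
    (ρ := ρ) (q := q) (s := δ - ε) hn hαn (by linarith) (by linarith) (by linarith) hq0
  obtain ⟨K₂, hK₂, H₂⟩ := exists_setLIntegral_shell_le (n := n) (m := m) (α := α) (β := β)
    (ρ := ρ) (q := q) (s := δ + ε) hn hαn (by linarith) (by linarith) (by linarith) hq0
  obtain ⟨C, hC, HC⟩ := exists_tsum_rpow_neg_abs_sub_le (c := q * ε) (by positivity)
  refine ⟨(K₁ + K₂ + 1) * C, by positivity, fun L a _ hsupp ha => ?_⟩
  have hX : (0 : ℝ) < 2 ^ L := by positivity
  have hsupp' : ∀ w, a w ≠ 0 → max (supAbs w.1) (supAbs w.2) ≤ (2 : ℝ) ^ L / 4 := fun w hw => by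
    refine (hsupp w hw).trans_eq ?_
    rw [zpow_sub₀ two_ne_zero]
    norm_num
  have ha' : ∀ w, |a w| ≤ (2 / (2 : ℝ) ^ L) ^ (n + m) := fun w => by
    refine (ha w).trans_eq ?_
    rw [mul_comm, zpow_mul, zpow_sub₀ two_ne_zero, zpow_one]
    exact_mod_cast rfl
  have hexp : ∀ (s : ℝ) (l : ℕ),
      ((2 : ℝ) ^ L) ^ ((α - n + β - m + (1 - ρ) * s) * q + n + m) *
        ((2 : ℝ) ^ l) ^ ((β - m + s) * q + m) =
      2 ^ (q * (s - δ) * ((l : ℝ) - (ρ - 1) * L)) := fun s l => by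
    rw [← Real.rpow_intCast, ← Real.rpow_natCast, ← Real.rpow_mul zero_le_two,
      ← Real.rpow_mul zero_le_two, ← Real.rpow_add zero_lt_two]
    congr 1
    have hβδ : β = m * θ - δ := by linarith
    rw [hαδ, hβδ]
    linear_combination (L * (n + m) + l * m : ℝ) * hqθ
  calc _ ≤ ∑' l : ℕ, ENNReal.ofReal (K₁ + K₂ + 1) *
        ENNReal.ofReal ((2 : ℝ) ^ (-(q * ε * |(l : ℝ) - (ρ - 1) * L|))) := by
        refine ENNReal.tsum_le_tsum fun l => ?_
        have hT : (1 : ℝ) ≤ 2 ^ l := one_le_pow₀ one_le_two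
        have e1 : (2 : ℝ) ^ (L + ((l : ℤ) + 1) - 1) = 2 ^ L * 2 ^ l := by
          rw [show L + ((l : ℤ) + 1) - 1 = L + l by ring, zpow_add₀ two_ne_zero, zpow_natCast]
        have e2 : (2 : ℝ) ^ (L + ((l : ℤ) + 1)) = 2 * (2 ^ L * 2 ^ l) := by
          rw [zpow_add₀ two_ne_zero, zpow_add₀ two_ne_zero, zpow_natCast, zpow_one]
          ring
        rw [e1, e2, ← ENNReal.ofReal_mul (by positivity)]
        rcases le_total 0 ((l : ℝ) - (ρ - 1) * L) with h | h
        · refine (H₁ _ _ a hX hT hsupp' ha').trans (ENNReal.ofReal_le_ofReal ?_)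
          rw [hexp, abs_of_nonneg h,
            show q * (δ - ε - δ) * ((l : ℝ) - (ρ - 1) * L) =
              -(q * ε * ((l : ℝ) - (ρ - 1) * L)) by ring]
          gcongr
          linarith
        · refine (H₂ _ _ a hX hT hsupp' ha').trans (ENNReal.ofReal_le_ofReal ?_)
          rw [hexp, abs_of_nonpos h,
            show q * (δ + ε - δ) * ((l : ℝ) - (ρ - 1) * L) =
              -(q * ε * -((l : ℝ) - (ρ - 1) * L)) by ring]
          gcongr
          linarith
    _ = ENNReal.ofReal (K₁ + K₂ + 1) *
        ∑' l : ℕ, ENNReal.ofReal ((2 : ℝ) ^ (-(q * ε * |(l : ℝ) - (ρ - 1) * L|))) :=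
        ENNReal.tsum_mul_left
    _ ≤ ENNReal.ofReal (K₁ + K₂ + 1) * ENNReal.ofReal C := by
        gcongr
        exact HC _
    _ = _ := (ENNReal.ofReal_mul (by positivity)).symm
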